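/- Every personalized bi-valued instance admits an EFX allocation; that is, for any finite set of agents with additive personalized bi-valued utilities over a finite set of goods, there exists a partition X = (X_1,…,X_n) of the goods such that for all agents i, j and every good g ∈ X_j, u_i(X_i) ≥ u_i(X_j \ {g}). -/

import Mathlib

open Finset

/-- Additive utility of a bundle: the sum of the values of the single goods in it. -/
def util {n : ℕ} {M : Type*} [DecidableEq M] (u : Fin n → M → ℝ) (i : Fin n)
    (S : Finset M) : ℝ :=
  ∑ g ∈ S, u i g

/-- `X` is an allocation: a partition of the set `M` of goods into `n` (possibly empty) bundles. -/
def IsAllocation {n : ℕ} {M : Type*} [DecidableEq M] (X : Fin n → Finset M) : Prop :=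
  (∀ g : M, ∃ i, g ∈ X i) ∧ ∀ i j : Fin n, i ≠ j → Disjoint (X i) (X j)

/-- `X` is EFX w.r.t. utilities `u`. -/
def IsEFX {n : ℕ} {M : Type*} [DecidableEq M] (u : Fin n → M → ℝ)
    (X : Fin n → Finset M) : Prop :=
  ∀ i j : Fin n, ∀ g ∈ X j, util u i ((X j).erase g) ≤ util u i (X i)

/-- `X'` Pareto-dominates `X` w.r.t. utilities `u`. -/
def ParetoDominates {n : ℕ} {M : Type*} [DecidableEq M] (u : Fin n → M → ℝ)
    (X' X : Fin n → Finset M) : Prop :=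
  (∀ i, util u i (X i) ≤ util u i (X' i)) ∧ ∃ j, util u j (X j) < util u j (X' j)

/-- `X` is Pareto-optimal: no allocation Pareto-dominates it. -/
def IsParetoOptimal {n : ℕ} {M : Type*} [DecidableEq M] (u : Fin n → M → ℝ)
    (X : Fin n → Finset M) : Prop :=
  ¬ ∃ X' : Fin n → Finset M, IsAllocation X' ∧ ParetoDominates u X' X

/-- The number of goods transferred (i.e. whose owner changes) when moving from
allocation `X` to allocation `X'`. -/
noncomputable def transferCount {n : ℕ} {M : Type*} [DecidableEq M]
    (X X' : Fin n → Finset M) : ℕ :=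
  Set.ncard {g : M | ∃ i, g ∈ X i ∧ g ∉ X' i}

/-- `X'` is a minimal Pareto-improvement of `X`: it is an allocation Pareto-dominating `X`
that minimizes the number of transferred goods among all such allocations. -/
def IsMinimalParetoImprovement {n : ℕ} {M : Type*} [DecidableEq M] (u : Fin n → M → ℝ)
    (X X' : Fin n → Finset M) : Prop :=
  IsAllocation X' ∧ ParetoDominates u X' X ∧
    ∀ X'' : Fin n → Finset M, IsAllocation X'' → ParetoDominates u X'' X →
      transferCount X X' ≤ transferCount X X''

/-- Hall-type exchange lemma. -/
lemma hall_exchange {ι M : Type*} [DecidableEq ι] [DecidableEq M] (N : ι → Finset M)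
    (A C : Finset ι) (μ : ι → M) (hinj : Set.InjOn μ A) (hμ : ∀ i ∈ A, μ i ∈ N i)
    (i : ι) (hi : i ∉ A) (hC : C ⊆ A)
    (h : ∀ B, i ∈ B → B ⊆ insert i C → ∃ x ∈ B, ∃ g ∈ N x, ∀ k ∈ B, k ≠ i → μ k ≠ g) :
    ∀ B ⊆ insert i C, #B ≤ #(B.biUnion N) := by
  intro B hB
  by_cases hiB : i ∈ B
  · obtain ⟨x, hx, g, hg, hne⟩ := h B hiB hB
    have hsub : ∀ k ∈ B.erase i, k ∈ A := by
      intro k hk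
      have := hB (mem_of_mem_erase hk)
      rw [mem_insert] at this
      rcases this with h | h
      · exact absurd h (ne_of_mem_erase hk)
      · exact hC h
    have h1 : insert g ((B.erase i).image μ) ⊆ B.biUnion N := by
      intro y hy
      rw [mem_insert] at hy
      rcases hy with rfl | hy
      · exact mem_biUnion.2 ⟨x, hx, hg⟩
      · obtain ⟨k, hk, rfl⟩ := mem_image.1 hy
        exact mem_biUnion.2 ⟨k, mem_of_mem_erase hk, hμ k (hsub k hk)⟩
    have h2 : g ∉ (B.erase i).image μ := by
      intro hy
      obtain ⟨k, hk, hkg⟩ := mem_image.1 hy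
      exact hne k (mem_of_mem_erase hk) (ne_of_mem_erase hk) hkg
    have h3 := card_le_card h1
    rw [card_insert_of_notMem h2, card_image_of_injOn, card_erase_of_mem hiB] at h3
    · have := card_pos.2 ⟨i, hiB⟩
      omega
    · intro p hp q hq
      exact hinj (hsub p hp) (hsub q hq)
  · have hsub : ∀ k ∈ B, k ∈ A := by
      intro k hk
      have := hB hk
      rw [mem_insert] at this
      rcases this with h | h
      · subst h; exact absurd hk hiB
      · exact hC h
    have h1 : B.image μ ⊆ B.biUnion N := by
      intro y hy
      obtain ⟨k, hk, rfl⟩ := mem_image.1 hy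
      exact mem_biUnion.2 ⟨k, hk, hμ k (hsub k hk)⟩
    have h3 := card_le_card h1
    rwa [card_image_of_injOn] at h3
    intro p hp q hq
    exact hinj (hsub p hp) (hsub q hq)

/-- Maximum-weight matching with its alternating reachability structure. -/
lemma matching_lemma {ι M : Type*} [DecidableEq ι] [DecidableEq M] [Nonempty M]
    (N : ι → Finset M) (W : Finset ι) (r : ι → ℝ) (hr : ∀ i, 1 ≤ r i) :
    ∃ (A F : Finset ι) (μ : ι → M) (ρ : ι → ℝ), A ⊆ W ∧ F ⊆ A ∧ Set.InjOn μ A ∧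
      (∀ i ∈ A, μ i ∈ N i) ∧
      (∀ i ∈ W, i ∉ A → ∀ g ∈ N i, ∃ k ∈ F, μ k = g ∧ r i ≤ ρ k) ∧
      (∀ j ∈ F, ∀ g ∈ N j, ∃ k ∈ F, μ k = g ∧ ρ j ≤ ρ k) ∧
      (∀ j ∈ F, ρ j ≤ r j ∧ 1 ≤ ρ j) ∧
      (F.Nonempty → ∃ i ∈ W, i ∉ A) := by
  classical
  let fam : Finset (Finset ι) := W.powerset.filter (fun A => ∀ B ⊆ A, #B ≤ #(B.biUnion N))
  have hne : fam.Nonempty := ⟨∅, by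
    simp only [fam, mem_filter, mem_powerset]
    refine ⟨empty_subset _, ?_⟩
    intro B hB
    rw [subset_empty.1 hB]; simp⟩
  obtain ⟨A, hA, hmax⟩ := exists_max_image fam (fun A => ∑ i ∈ A, r i) hne
  simp only [fam, mem_filter, mem_powerset] at hA hmax
  obtain ⟨hAW, hAH⟩ := hA
  have hex : ∃ μ : ι → M, Set.InjOn μ A ∧ ∀ i ∈ A, μ i ∈ N i := by
    have := (Finset.all_card_le_biUnion_card_iff_exists_injective (fun i : A => N i)).1 (by
      intro s
      have := hAH (s.map (Function.Embedding.subtype _)) (by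
        intro x hx
        obtain ⟨y, _, rfl⟩ := mem_map.1 hx
        exact y.2)
      rw [card_map] at this
      refine this.trans (card_le_card ?_)
      intro g hg
      simp only [mem_biUnion, mem_map] at hg ⊢
      obtain ⟨x, ⟨y, hy, rfl⟩, hg⟩ := hg
      exact ⟨y, hy, hg⟩)
    obtain ⟨f, hf, hf2⟩ := this
    refine ⟨fun i => if h : i ∈ A then f ⟨i, h⟩ else Classical.arbitrary M, ?_, ?_⟩
    · intro p hp q hq hpq
      simp only [mem_coe] at hp hq
      simp only [hp, hq, dif_pos] at hpq
      have := hf hpq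
      simpa using this
    · intro i hi
      simp only [hi, dif_pos]
      exact hf2 ⟨i, hi⟩
  obtain ⟨μ, hinj, hμ⟩ := hex
  let step : ι → ι → Prop := fun x k => k ∈ A ∧ μ k ∈ N x
  let Re : ι → ι → Prop := Relation.ReflTransGen step
  -- closure of sets
  have hclosed : ∀ i j, Re i j → ∀ B : Finset ι, i ∈ B →
      (∀ x ∈ B, ∀ k, step x k → k ∈ B) → j ∈ B := by
    intro i j h B hi hB
    induction h with
    | refl => exact hi
    | tail _ h2 ih => exact hB _ ih _ h2
  have haug : ∀ i ∈ W, i ∉ A → ∀ j, Re i j → ∀ g ∈ N j, ∃ k ∈ A, μ k = g := by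
    intro i hiW hiA j hij g hg
    by_contra hcon
    push Not at hcon
    have hH := hall_exchange N A A μ hinj hμ i hiA (Subset.refl _) (by
      intro B hiB hB
      by_contra hno
      push Not at hno
      have hj : j ∈ B := hclosed i j hij B hiB (by
        intro x hx k hk
        obtain ⟨k', hk', hk'i, he⟩ := hno x hx (μ k) hk.2
        have : k' ∈ A := by
          rcases mem_insert.1 (hB hk') with h | h
          · exact absurd h hk'i
          · exact h
        rwa [← hinj this hk.1 he])
      obtain ⟨k, hk, hki, he⟩ := hno j hj g hg
      rcases mem_insert.1 (hB hk) with h | h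
      · exact hki h
      · exact hcon k h he)
    have := hmax (insert i A) ⟨insert_subset hiW hAW, hH⟩
    rw [sum_insert hiA] at this
    linarith [hr i]
  have hswap : ∀ i ∈ W, i ∉ A → ∀ j ∈ A, Re i j → r i ≤ r j := by
    intro i hiW hiA j hjA hij
    have hH := hall_exchange N A (A.erase j) μ hinj hμ i hiA (erase_subset _ _) (by
      intro B hiB hB
      by_contra hno
      push Not at hno
      have hj : j ∈ B := hclosed i j hij B hiB (by
        intro x hx k hk
        obtain ⟨k', hk', hk'i, he⟩ := hno x hx (μ k) hk.2
        have : k' ∈ A := by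
          rcases mem_insert.1 (hB hk') with h | h
          · exact absurd h hk'i
          · exact mem_of_mem_erase h
        rwa [← hinj this hk.1 he])
      rcases mem_insert.1 (hB hj) with h | h
      · subst h; exact hiA hjA
      · exact notMem_erase _ _ h)
    have := hmax (insert i (A.erase j))
      ⟨insert_subset hiW ((erase_subset _ _).trans hAW), hH⟩
    rw [sum_insert (fun h => hiA (mem_of_mem_erase h))] at this
    have h2 := add_sum_erase A r hjA
    linarith
  have hρ : ∀ j, ∃ ρ : ℝ, (∃ i ∈ W, i ∉ A ∧ Re i j) →
      (∃ i ∈ W, i ∉ A ∧ Re i j ∧ ρ = r i) ∧ ∀ i ∈ W, i ∉ A → Re i j → r i ≤ ρ := by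
    intro j
    by_cases h : ∃ i ∈ W, i ∉ A ∧ Re i j
    · obtain ⟨i, hi1, hi2, hi3⟩ := h
      obtain ⟨i', hi', hm⟩ := exists_max_image (W.filter (fun i => i ∉ A ∧ Re i j)) r
        ⟨i, by simp [hi1, hi2, hi3]⟩
      simp only [mem_filter] at hi' hm
      exact ⟨r i', fun _ => ⟨⟨i', hi'.1, hi'.2.1, hi'.2.2, rfl⟩,
        fun x h1 h2 h3 => hm x ⟨h1, h2, h3⟩⟩⟩
    · exact ⟨0, fun h' => absurd h' h⟩
  choose ρ hρ using hρ
  refine ⟨A, A.filter (fun j => ∃ i ∈ W, i ∉ A ∧ Re i j), μ, ρ, hAW, filter_subset _ _,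
    hinj, hμ, ?_, ?_, ?_, ?_⟩
  · intro i hiW hiA g hg
    obtain ⟨k, hk, rfl⟩ := haug i hiW hiA i Relation.ReflTransGen.refl g hg
    have hre : Re i k := Relation.ReflTransGen.single ⟨hk, hg⟩
    exact ⟨k, mem_filter.2 ⟨hk, i, hiW, hiA, hre⟩, rfl, (hρ k ⟨i, hiW, hiA, hre⟩).2 i hiW hiA hre⟩
  · intro j hj g hg
    obtain ⟨hjA, hjr⟩ := mem_filter.1 hj
    obtain ⟨⟨i, hiW, hiA, hij, he⟩, _⟩ := hρ j hjr
    obtain ⟨k, hk, rfl⟩ := haug i hiW hiA j hij g hg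
    have hre : Re i k := Relation.ReflTransGen.tail hij ⟨hk, hg⟩
    refine ⟨k, mem_filter.2 ⟨hk, i, hiW, hiA, hre⟩, rfl, ?_⟩
    rw [he]
    exact (hρ k ⟨i, hiW, hiA, hre⟩).2 i hiW hiA hre
  · intro j hj
    obtain ⟨hjA, hjr⟩ := mem_filter.1 hj
    obtain ⟨⟨i, hiW, hiA, hij, he⟩, _⟩ := hρ j hjr
    rw [he]
    exact ⟨hswap i hiW hiA j hjA hij, hr i⟩
  · rintro ⟨j, hj⟩
    obtain ⟨hjA, i, hiW, hiA, _⟩ := mem_filter.1 hj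
    exact ⟨i, hiW, hiA⟩

/-- Extending a partial injection to a chosen set of agents. -/
lemma extend_inj {ι M : Type*} [DecidableEq ι] [DecidableEq M]
    (A S : Finset ι) (P : Finset M) (μ : ι → M) (hAS : A ⊆ S) (hinj : Set.InjOn μ A)
    (hμ : ∀ i ∈ A, μ i ∈ P) (hcard : #S ≤ #P) :
    ∃ ν : ι → M, Set.InjOn ν S ∧ (∀ i ∈ S, ν i ∈ P) ∧ (∀ i ∈ A, ν i = μ i) := by
  classical
  have himg : A.image μ ⊆ P := by
    intro y hy
    obtain ⟨k, hk, rfl⟩ := mem_image.1 hy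
    exact hμ k hk
  have hc : #(A.image μ) ≤ #S := card_image_le.trans (card_le_card hAS)
  obtain ⟨P', h1, h2, h3⟩ := exists_subsuperset_card_eq himg hc hcard
  have hα : Fintype.card S = #P' := by simp [h3]
  obtain ⟨f, hf⟩ := Finset.exists_equiv_extend_of_card_eq (α := S) (t := P') hα
    (s := univ.filter (fun x : S => (x : ι) ∈ A)) (f := fun x : S => μ x)
    (by
      intro y hy
      obtain ⟨k, hk, rfl⟩ := mem_image.1 hy
      exact h1 (mem_image_of_mem _ (by simpa using hk)))
    (by
      intro p hp q hq hpq
      simp only [coe_filter, mem_univ, true_and, Set.mem_ofPred_eq] at hp hq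
      exact Subtype.ext (hinj hp hq hpq))
  refine ⟨fun i => if h : i ∈ S then (f ⟨i, h⟩ : M) else μ i, ?_, ?_, ?_⟩
  · intro p hp q hq hpq
    simp only [mem_coe] at hp hq
    simp only [hp, hq, dif_pos] at hpq
    have := f.injective (Subtype.ext hpq)
    simpa using this
  · intro i hi
    simp only [hi, dif_pos]
    exact h2 (f ⟨i, hi⟩).2
  · intro i hi
    simp only [hAS hi, dif_pos]
    exact hf ⟨i, hAS hi⟩ (by simpa using hi)

/-- Number of goods in `S` that are large for agent `i`. -/
noncomputable def Lc {n : ℕ} {M : Type*} (u : Fin n → M → ℝ) (a : Fin n → ℝ) (i : Fin n)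
    (S : Finset M) : ℕ := by
  classical exact #(S.filter (fun g => u i g = a i))

lemma Lc_le {n : ℕ} {M : Type*} (u : Fin n → M → ℝ) (a : Fin n → ℝ) (i : Fin n)
    (S : Finset M) : Lc u a i S ≤ #S := by
  classical
  unfold Lc
  exact card_filter_le _ _

lemma Lc_mono {n : ℕ} {M : Type*} (u : Fin n → M → ℝ) (a : Fin n → ℝ) (i : Fin n)
    {S S' : Finset M} (h : S ⊆ S') : Lc u a i S ≤ Lc u a i S' := by
  classical
  unfold Lc
  exact card_le_card (filter_subset_filter _ h)

lemma Lc_all {n : ℕ} {M : Type*} (u : Fin n → M → ℝ) (a : Fin n → ℝ) (i : Fin n)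
    {S : Finset M} (h : ∀ g ∈ S, u i g = a i) : Lc u a i S = #S := by
  classical
  unfold Lc
  rw [filter_true_of_mem h]

lemma Lc_insert_small {n : ℕ} {M : Type*} [DecidableEq M] (u : Fin n → M → ℝ) (a : Fin n → ℝ)
    (i : Fin n) {S : Finset M} {g : M} (h : u i g ≠ a i) :
    Lc u a i (insert g S) = Lc u a i S := by
  classical
  unfold Lc
  congr 1
  ext x
  simp only [mem_filter, mem_insert]
  constructor
  · rintro ⟨rfl | h1, h2⟩
    · exact absurd h2 h
    · exact ⟨h1, h2⟩
  · rintro ⟨h1, h2⟩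
    exact ⟨Or.inr h1, h2⟩

lemma util_eq {n : ℕ} {M : Type*} [DecidableEq M] (u : Fin n → M → ℝ) (a b : Fin n → ℝ)
    (hbi : ∀ i g, u i g = a i ∨ u i g = b i) (i : Fin n) (S : Finset M) :
    util u i S = b i * #S + (a i - b i) * Lc u a i S := by
  classical
  unfold util Lc
  have h : ∀ g ∈ S, u i g = b i + (if u i g = a i then a i - b i else 0) := by
    intro g _
    split_ifs with h
    · rw [h]; ring
    · rcases hbi i g with h' | h'
      · exact absurd h' h
      · rw [h']; ring
  rw [sum_congr rfl h, sum_add_distrib, ← sum_filter]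
  simp only [sum_const, nsmul_eq_mul]
  ring

/-- The invariant of the match-and-freeze procedure after `s` rounds with slack `e`. -/
structure RoundInv {n : ℕ} {M : Type*} [DecidableEq M] (u : Fin n → M → ℝ) (a b : Fin n → ℝ)
    (X : Fin n → Finset M) (U F : Finset (Fin n)) (t T : Fin n → ℕ) (s e : ℕ) : Prop where
  disj : ∀ i j, i ≠ j → Disjoint (X i) (X j)
  UF : ∀ i ∈ U, i ∉ F
  nF : ∃ i, i ∉ F
  c : ∀ j, #(X j) ≤ s
  W : ∀ i, i ∉ U → i ∉ F → #(X i) = s ∧ ∀ g ∈ X i, u i g = a i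
  tpos : ∀ i, i ∈ U ∨ i ∈ F → 1 ≤ t i ∧ t i ≤ s
  U1 : ∀ i ∈ U, s ≤ #(X i) + e ∧ t i ≤ Lc u a i (X i) + 1
  R2 : ∀ i, i ∈ U ∨ i ∈ F → ∀ g, (∀ j, g ∉ X j) → u i g ≠ a i
  U3 : ∀ i ∈ U, ∀ j, Lc u a i (X j) + 1 ≤ t i ∨
    (Lc u a i (X j) ≤ t i ∧ j ∈ F ∧ t j = t i ∧ a i ≤ (T j + 2) * b i)
  F1 : ∀ j ∈ F, t j ≤ Lc u a j (X j) ∧ s ≤ #(X j) + T j + e ∧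
    (#(X j) ≤ t j ∨ #(X j) + T j ≤ s) ∧ (T j + 1) * b j ≤ a j
  F3 : ∀ j ∈ F, ∀ k, Lc u a j (X k) + 1 ≤ t j ∨
    (Lc u a j (X k) ≤ t j ∧ k ∈ F ∧ t k = t j ∧ T j ≤ T k)
  D : (∀ i ∈ U, s ≤ #(X i)) ∨ (∀ j ∈ F, #(X j) ≤ t j ∨ #(X j) + T j + 1 ≤ s)

/-- Comparison helper. -/
lemma cmp_le {b d x y : ℝ} {c c' l l' : ℕ} (hb : 0 < b) (hd : 0 < d)
    (hx : x = b * c' + d * l') (hy : y = b * c + d * l) (hc : c' ≤ c) (hl : l' ≤ l) : x ≤ y := by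
  have h1 : b * (c' : ℝ) ≤ b * c := by gcongr
  have h2 : d * (l' : ℝ) ≤ d * l := by gcongr
  linarith

lemma efx_of_inv {n : ℕ} {M : Type*} [DecidableEq M] (u : Fin n → M → ℝ) (a b : Fin n → ℝ)
    (hab : ∀ i, b i < a i) (hb : ∀ i, 0 < b i)
    (hbi : ∀ i g, u i g = a i ∨ u i g = b i)
    (X : Fin n → Finset M) (U F : Finset (Fin n)) (t T : Fin n → ℕ) (s e : ℕ) (he : e ≤ 1)
    (h : RoundInv u a b X U F t T s e) : IsEFX u X := by
  intro i j g hg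
  have hd : 0 < a i - b i := sub_pos.2 (hab i)
  have hbp := hb i
  have hx := util_eq u a b hbi i ((X j).erase g)
  have hy := util_eq u a b hbi i (X i)
  have hc' : #((X j).erase g) + 1 = #(X j) := card_erase_add_one hg
  have hl1 := Lc_le u a i ((X j).erase g)
  have hl2 := Lc_mono u a i (erase_subset g (X j))
  have hl3 := Lc_le u a i (X i)
  have hcj := h.c j
  set c' := #((X j).erase g)
  set l' := Lc u a i ((X j).erase g)
  set l := Lc u a i (X i)
  set c := #(X i)
  by_cases hU : i ∈ U
  · have h1 := h.U1 i hU
    have h0 := h.tpos i (Or.inl hU)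
    rcases h.U3 i hU j with h3 | ⟨h3, hjF, htj, hT⟩
    · exact cmp_le hbp hd hx hy (by omega) (by omega)
    · obtain ⟨_, _, f3, _⟩ := h.F1 j hjF
      by_cases hle : #(X j) ≤ t j
      · exact cmp_le hbp hd hx hy (by omega) (by omega)
      · have key : c' + T j + 1 ≤ c ∧ l' ≤ l + 1 := by
          refine ⟨?_, by omega⟩
          rcases h.D with hD | hD
          · have := hD i hU
            omega
          · have := hD j hjF
            omega
        have k1 : b i * ((c' : ℝ) + T j + 1) ≤ b i * c := by
          have : ((c' : ℝ) + T j + 1) ≤ c := by exact_mod_cast key.1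
          gcongr
        have k2 : (a i - b i) * (l' : ℝ) ≤ (a i - b i) * (l + 1) := by
          have : (l' : ℝ) ≤ l + 1 := by exact_mod_cast key.2
          gcongr
        rw [hx, hy]
        linarith
  · by_cases hF : i ∈ F
    · obtain ⟨f1, f2, f3, f4⟩ := h.F1 i hF
      have h0 := h.tpos i (Or.inr hF)
      rcases h.F3 i hF j with h3 | ⟨h3, hjF, htj, hT⟩
      · have key : c' ≤ c + T i ∧ l' + 1 ≤ l := by
          omega
        have k1 : b i * (c' : ℝ) ≤ b i * (c + T i) := by
          have : (c' : ℝ) ≤ c + T i := by exact_mod_cast key.1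
          gcongr
        have k2 : (a i - b i) * ((l' : ℝ) + 1) ≤ (a i - b i) * l := by
          have : (l' : ℝ) + 1 ≤ l := by exact_mod_cast key.2
          gcongr
        rw [hx, hy]
        linarith
      · obtain ⟨_, _, f3', _⟩ := h.F1 j hjF
        exact cmp_le hbp hd hx hy (by omega) (by omega)
    · obtain ⟨w1, w2⟩ := h.W i hU hF
      have : l = c := Lc_all u a i w2
      exact cmp_le hbp hd hx hy (by omega) (by omega)

/-- Choice of the served set in a round. -/
lemma choose_served {ι : Type*} [DecidableEq ι] (A B C : Finset ι) (p : ℕ) (hAB : A ⊆ B)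
    (hBC : B ⊆ C) (hA : #A ≤ p) :
    ∃ S, A ⊆ S ∧ S ⊆ C ∧ #S ≤ p ∧ (S = C ∨ #S = p) ∧ (B ⊆ S ∨ S ⊆ B) := by
  by_cases h1 : #C ≤ p
  · exact ⟨C, hAB.trans hBC, Subset.refl _, h1, Or.inl rfl, Or.inl hBC⟩
  · push Not at h1
    by_cases h2 : #B ≤ p
    · obtain ⟨S, s1, s2, s3⟩ := exists_subsuperset_card_eq hBC h2 h1.le
      exact ⟨S, hAB.trans s1, s2, s3.le, Or.inr s3, Or.inl s1⟩
    · push Not at h2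
      obtain ⟨S, s1, s2, s3⟩ := exists_subsuperset_card_eq hAB hA h2.le
      exact ⟨S, s1, s2.trans hBC, s3.le, Or.inr s3, Or.inr s2⟩

/-- One round of match-and-freeze. -/
lemma round_step {n : ℕ} {M : Type*} [Fintype M] [DecidableEq M] (u : Fin n → M → ℝ)
    (a b : Fin n → ℝ) (hab : ∀ i, b i < a i) (hb : ∀ i, 0 < b i)
    (X : Fin n → Finset M) (U F : Finset (Fin n)) (t T : Fin n → ℕ) (s : ℕ)
    (h : RoundInv u a b X U F t T s 0) (P : Finset M) (hP : ∀ g, g ∈ P ↔ ∀ j, g ∉ X j)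
    (hPne : P.Nonempty) :
    ∃ X' U' F' t' T' e, RoundInv u a b X' U' F' t' T' (s + 1) e ∧
      ((e = 0 ∧ ∃ P' : Finset M, (∀ g, g ∈ P' ↔ ∀ j, g ∉ X' j) ∧ #P' < #P) ∨
        (e = 1 ∧ ∀ g, ∃ j, g ∈ X' j)) := by
  classical
  obtain ⟨g0, hg0⟩ := hPne
  have : Nonempty M := ⟨g0⟩
  let W : Finset (Fin n) := univ.filter (fun i => i ∉ U ∧ i ∉ F)
  have hW : ∀ i, i ∈ W ↔ i ∉ U ∧ i ∉ F := by intro i; simp [W]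
  obtain ⟨A, F', μ0, ρ, hAW, hF'A, hinj0, hμ0, m1, m2, m3, m4⟩ :=
    matching_lemma (fun i => P.filter (fun g => u i g = a i)) W (fun i => a i / b i)
      (fun i => by rw [le_div_iff₀ (hb i)]; linarith [hab i])
  simp only [mem_filter] at hμ0 m1 m2
  have hAP : #A ≤ #P := by
    rw [← card_image_of_injOn hinj0]
    apply card_le_card
    intro y hy
    obtain ⟨k, hk, rfl⟩ := mem_image.1 hy
    exact (hμ0 k hk).1
  let B : Finset (Fin n) := univ.filter (fun i => i ∉ F)
  let C : Finset (Fin n) := univ.filter (fun i => i ∉ F ∨ t i + T i ≤ s)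
  have hB : ∀ i, i ∈ B ↔ i ∉ F := by intro i; simp [B]
  have hC : ∀ i, i ∈ C ↔ (i ∉ F ∨ t i + T i ≤ s) := by intro i; simp [C]
  obtain ⟨S, hAS, hSC, hSP, hS1, hS2⟩ := choose_served A B C #P
    (fun i hi => (hB i).2 ((hW i).1 (hAW hi)).2) (fun i hi => (hC i).2 (Or.inl ((hB i).1 hi))) hAP
  obtain ⟨μ, hinj, hμP, hμA⟩ := extend_inj A S P μ0 hAS hinj0 (fun i hi => (hμ0 i hi).1) hSP
  let X' : Fin n → Finset M := fun i => if i ∈ S then insert (μ i) (X i) else X i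
  have hX'S : ∀ i ∈ S, X' i = insert (μ i) (X i) := fun i hi => if_pos hi
  have hX'N : ∀ i, i ∉ S → X' i = X i := fun i hi => if_neg hi
  have hfresh : ∀ i ∈ S, ∀ j, μ i ∉ X j := fun i hi => (hP _).1 (hμP i hi)
  have hcS : ∀ i ∈ S, #(X' i) = #(X i) + 1 := by
    intro i hi
    rw [hX'S i hi, card_insert_of_notMem (hfresh i hi i)]
  have hcN : ∀ i, i ∉ S → #(X' i) = #(X i) := by
    intro i hi
    rw [hX'N i hi]
  have hmono : ∀ i, X i ⊆ X' i := by
    intro i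
    by_cases hi : i ∈ S
    · rw [hX'S i hi]; exact subset_insert _ _
    · rw [hX'N i hi]
  have hmem : ∀ i g, g ∈ X' i ↔ g ∈ X i ∨ (i ∈ S ∧ g = μ i) := by
    intro i g
    by_cases hi : i ∈ S
    · rw [hX'S i hi, mem_insert]; tauto
    · rw [hX'N i hi]; tauto
  have hcle : ∀ i, #(X' i) ≤ s + 1 := by
    intro i
    have := h.c i
    by_cases hi : i ∈ S
    · rw [hcS i hi]; omega
    · rw [hcN i hi]; omega
  have hcge : ∀ i, #(X i) ≤ #(X' i) := fun i => card_le_card (hmono i)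
  -- old agents see no change in the number of large goods
  have hLold : ∀ i, (i ∈ U ∨ i ∈ F) → ∀ j, Lc u a i (X' j) = Lc u a i (X j) := by
    intro i hi j
    by_cases hj : j ∈ S
    · rw [hX'S j hj]
      exact Lc_insert_small u a i (h.R2 i hi _ (hfresh j hj))
    · rw [hX'N j hj]
  -- new agents
  have hLnew : ∀ i j, Lc u a i (X' j) ≤ s ∨ (j ∈ S ∧ u i (μ j) = a i) := by
    intro i j
    have h1 := h.c j
    have h2 := Lc_le u a i (X j)
    by_cases hj : j ∈ S
    · by_cases hl : u i (μ j) = a i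
      · exact Or.inr ⟨hj, hl⟩
      · left
        rw [hX'S j hj, Lc_insert_small u a i hl]; omega
    · left
      rw [hX'N j hj]; omega
  have hLs : ∀ i j, Lc u a i (X' j) ≤ s + 1 := fun i j => (Lc_le u a i _).trans (hcle j)
  have hF'W : ∀ i ∈ F', i ∉ U ∧ i ∉ F := fun i hi => (hW i).1 (hAW (hF'A hi))
  let U2 : Finset (Fin n) := U ∪ (W \ A)
  have hU2 : ∀ i, i ∈ U2 ↔ i ∈ U ∨ (i ∈ W ∧ i ∉ A) := by intro i; simp [U2]
  let F2 : Finset (Fin n) := F ∪ F'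
  have hF2 : ∀ i, i ∈ F2 ↔ i ∈ F ∨ i ∈ F' := by intro i; simp [F2]
  let t' : Fin n → ℕ := fun i => if i ∈ W then s + 1 else t i
  have ht'W : ∀ i ∈ W, t' i = s + 1 := fun i hi => if_pos hi
  have ht'U : ∀ i ∈ U, t' i = t i := fun i hi => if_neg (fun hw => ((hW i).1 hw).1 hi)
  have ht'F : ∀ i ∈ F, t' i = t i := fun i hi => if_neg (fun hw => ((hW i).1 hw).2 hi)
  let T' : Fin n → ℕ := fun i => if i ∈ W then ⌊ρ i⌋₊ - 1 else T i
  have hT'W : ∀ i ∈ W, T' i = ⌊ρ i⌋₊ - 1 := fun i hi => if_pos hi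
  have hT'F : ∀ i ∈ F, T' i = T i := fun i hi => if_neg (fun hw => ((hW i).1 hw).2 hi)
  have hF'inW : ∀ i ∈ F', i ∈ W := fun i hi => hAW (hF'A hi)
  have hF'S : ∀ i ∈ F', i ∈ S := fun i hi => hAS (hF'A hi)
  have hWL : ∀ i ∈ W, Lc u a i (X i) = s := by
    intro i hi
    obtain ⟨h1, h2⟩ := h.W i ((hW i).1 hi).1 ((hW i).1 hi).2
    rw [Lc_all u a i h2, h1]
  have hAlarge : ∀ i ∈ A, ∀ g ∈ X' i, u i g = a i := by
    intro i hi g hg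
    rcases (hmem i g).1 hg with hg | ⟨_, rfl⟩
    · exact (h.W i ((hW i).1 (hAW hi)).1 ((hW i).1 (hAW hi)).2).2 g hg
    · rw [hμA i hi]; exact (hμ0 i hi).2
  have hAcard : ∀ i ∈ A, #(X' i) = s + 1 := by
    intro i hi
    rw [hcS i (hAS hi), (h.W i ((hW i).1 (hAW hi)).1 ((hW i).1 (hAW hi)).2).1]
  have hfl1 : ∀ j ∈ F', ((T' j : ℝ) + 1) ≤ ρ j := by
    intro j hj
    have h1 := (m3 j hj).2
    have h2 : 1 ≤ ⌊ρ j⌋₊ := Nat.le_floor (by simpa using h1)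
    rw [hT'W j (hF'inW j hj)]
    have h3 := Nat.floor_le (zero_le_one.trans h1)
    push_cast [Nat.cast_sub h2]
    linarith
  have hfl2 : ∀ j ∈ F', ρ j ≤ ((T' j : ℝ) + 2) := by
    intro j hj
    have h1 := (m3 j hj).2
    have h2 : 1 ≤ ⌊ρ j⌋₊ := Nat.le_floor (by simpa using h1)
    rw [hT'W j (hF'inW j hj)]
    have h3 := Nat.lt_floor_add_one (ρ j)
    push_cast [Nat.cast_sub h2]
    linarith
  -- the main invariant
  have main : ∀ e, (S = C ∨ e = 1) → RoundInv u a b X' U2 F2 t' T' (s + 1) e := by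
    intro e he
    refine ⟨?_, ?_, ?_, hcle, ?_, ?_, ?_, ?_, ?_, ?_, ?_, ?_⟩
    · intro i j hij
      rw [disjoint_left]
      intro g hi hj
      rcases (hmem i g).1 hi with h1 | ⟨h1, rfl⟩
      · rcases (hmem j g).1 hj with h2 | ⟨h2, rfl⟩
        · exact disjoint_left.1 (h.disj i j hij) h1 h2
        · exact hfresh j h2 i h1
      · rcases (hmem j _).1 hj with h2 | ⟨h2, h3⟩
        · exact hfresh i h1 j h2
        · exact hij (hinj h1 h2 h3)
    · intro i hi hiF
      rcases (hU2 i).1 hi with h1 | ⟨h1, h2⟩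
      · rcases (hF2 i).1 hiF with h3 | h3
        · exact h.UF i h1 h3
        · exact (hF'W i h3).1 h1
      · rcases (hF2 i).1 hiF with h3 | h3
        · exact ((hW i).1 h1).2 h3
        · exact h2 (hF'A h3)
    · by_cases hne : F'.Nonempty
      · obtain ⟨i, hi, hiA⟩ := m4 hne
        refine ⟨i, fun hiF => ?_⟩
        rcases (hF2 i).1 hiF with h3 | h3
        · exact ((hW i).1 hi).2 h3
        · exact hiA (hF'A h3)
      · obtain ⟨i, hi⟩ := h.nF
        refine ⟨i, fun hiF => ?_⟩
        rcases (hF2 i).1 hiF with h3 | h3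
        · exact hi h3
        · exact hne ⟨i, h3⟩
    · intro i hiU hiF
      have hiA : i ∈ A := by
        by_contra hiA
        apply hiU
        rw [hU2]
        by_cases h1 : i ∈ U
        · exact Or.inl h1
        · exact Or.inr ⟨(hW i).2 ⟨h1, fun h2 => hiF ((hF2 i).2 (Or.inl h2))⟩, hiA⟩
      exact ⟨hAcard i hiA, hAlarge i hiA⟩
    · intro i hi
      by_cases hw : i ∈ W
      · rw [ht'W i hw]; omega
      · have : i ∈ U ∨ i ∈ F := by
          by_contra hcon
          push Not at hcon
          exact hw ((hW i).2 hcon)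
        have h1 := h.tpos i this
        have : t' i = t i := if_neg hw
        omega
    · intro i hi
      have key : s ≤ #(X i) ∧ (t' i ≤ Lc u a i (X' i) + 1) := by
        rcases (hU2 i).1 hi with h1 | ⟨h1, h2⟩
        · have h3 := h.U1 i h1
          rw [ht'U i h1, hLold i (Or.inl h1)]
          omega
        · have h3 := hWL i h1
          have h4 := Lc_mono u a i (hmono i)
          have h5 := Lc_le u a i (X i)
          rw [ht'W i h1]
          omega
      refine ⟨?_, key.2⟩
      by_cases hiS : i ∈ S
      · rw [hcS i hiS]; omega
      · rw [hcN i hiS]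
        rcases he with he | he
        · exfalso
          apply hiS
          rw [he, hC]
          left
          rcases (hU2 i).1 hi with h1 | ⟨h1, h2⟩
          · exact h.UF i h1
          · exact ((hW i).1 h1).2
        · omega
    · intro i hi g hg hug
      have hgX : ∀ j, g ∉ X j := fun j hj => hg j (hmono j hj)
      have hgP : g ∈ P := (hP g).2 hgX
      have hno : ∀ k ∈ F', μ0 k ≠ g := by
        intro k hk he
        exact hg k ((hmem k g).2 (Or.inr ⟨hF'S k hk, by rw [hμA k (hF'A hk), he]⟩))
      by_cases hold : i ∈ U ∨ i ∈ F
      · exact h.R2 i hold g hgX hug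
      · rcases hi with hi | hi
        · rcases (hU2 i).1 hi with h1 | ⟨h1, h2⟩
          · exact hold (Or.inl h1)
          · obtain ⟨k, hk, he, _⟩ := m1 i h1 h2 g ⟨hgP, hug⟩
            exact hno k hk he
        · rcases (hF2 i).1 hi with h1 | h1
          · exact hold (Or.inr h1)
          · obtain ⟨k, hk, he, _⟩ := m2 i h1 g ⟨hgP, hug⟩
            exact hno k hk he
    · intro i hi j
      rcases (hU2 i).1 hi with h1 | ⟨h1, h2⟩
      · rw [hLold i (Or.inl h1), ht'U i h1]
        rcases h.U3 i h1 j with h3 | ⟨h3, h4, h5, h6⟩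
        · exact Or.inl h3
        · refine Or.inr ⟨h3, (hF2 j).2 (Or.inl h4), ?_, ?_⟩
          · rw [ht'F j h4, h5]
          · rw [hT'F j h4]; exact h6
      · rw [ht'W i h1]
        rcases hLnew i j with h3 | ⟨h3, h4⟩
        · left; omega
        · right
          obtain ⟨k, hk, hke, hkr⟩ := m1 i h1 h2 (μ j) ⟨hμP j h3, h4⟩
          have hkj : k = j := hinj (hF'S k hk) h3 (by rw [hμA k (hF'A hk), hke])
          subst hkj
          refine ⟨hLs i k, (hF2 k).2 (Or.inr hk), ht'W k (hF'inW k hk), ?_⟩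
          rw [← div_le_iff₀ (hb i)]
          exact hkr.trans (hfl2 k hk)
    · intro j hj
      rcases (hF2 j).1 hj with h1 | h1
      · obtain ⟨f1, f2, f3, f4⟩ := h.F1 j h1
        rw [ht'F j h1, hT'F j h1, hLold j (Or.inr h1)]
        have hL := Lc_le u a j (X j)
        refine ⟨f1, ?_, ?_, f4⟩
        · by_cases hjS : j ∈ S
          · rw [hcS j hjS]; omega
          · rw [hcN j hjS]
            rcases he with he | he
            · have : ¬ (t j + T j ≤ s) := fun hh => hjS (by rw [he, hC]; exact Or.inr hh)
              omega
            · omega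
        · by_cases hjS : j ∈ S
          · rw [hcS j hjS]
            have : t j + T j ≤ s := by
              rcases (hC j).1 (hSC hjS) with h2 | h2
              · exact absurd h1 h2
              · exact h2
            omega
          · rw [hcN j hjS]; omega
      · have hc := hAcard j (hF'A h1)
        rw [ht'W j (hF'inW j h1), Lc_all u a j (hAlarge j (hF'A h1)), hc]
        refine ⟨le_rfl, by omega, Or.inl le_rfl, ?_⟩
        rw [← le_div_iff₀ (hb j)]
        exact (hfl1 j h1).trans (m3 j h1).1
    · intro i hi j
      rcases (hF2 i).1 hi with h1 | h1
      · rw [hLold i (Or.inr h1), ht'F i h1, hT'F i h1]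
        rcases h.F3 i h1 j with h3 | ⟨h3, h4, h5, h6⟩
        · exact Or.inl h3
        · refine Or.inr ⟨h3, (hF2 j).2 (Or.inl h4), ?_, ?_⟩
          · rw [ht'F j h4, h5]
          · rw [hT'F j h4]; exact h6
      · rw [ht'W i (hF'inW i h1)]
        rcases hLnew i j with h3 | ⟨h3, h4⟩
        · left; omega
        · right
          obtain ⟨k, hk, hke, hkr⟩ := m2 i h1 (μ j) ⟨hμP j h3, h4⟩
          have hkj : k = j := hinj (hF'S k hk) h3 (by rw [hμA k (hF'A hk), hke])
          subst hkj
          refine ⟨hLs i k, (hF2 k).2 (Or.inr hk), ht'W k (hF'inW k hk), ?_⟩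
          rw [hT'W i (hF'inW i h1), hT'W k (hF'inW k hk)]
          exact Nat.sub_le_sub_right (Nat.floor_le_floor hkr) 1
    · rcases hS2 with hBS | hSB
      · left
        intro i hi
        have key : i ∉ F ∧ s ≤ #(X i) := by
          rcases (hU2 i).1 hi with h1 | ⟨h1, h2⟩
          · exact ⟨h.UF i h1, (h.U1 i h1).1⟩
          · exact ⟨((hW i).1 h1).2, (h.W i ((hW i).1 h1).1 ((hW i).1 h1).2).1.ge⟩
        rw [hcS i (hBS ((hB i).2 key.1))]
        omega
      · right
        intro j hj
        rcases (hF2 j).1 hj with h1 | h1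
        · have hjS : j ∉ S := fun hh => (hB j).1 (hSB hh) h1
          obtain ⟨f1, f2, f3, f4⟩ := h.F1 j h1
          rw [hcN j hjS, ht'F j h1, hT'F j h1]
          omega
        · left
          rw [ht'W j (hF'inW j h1)]
          exact hcle j
  rcases hS1 with hS1 | hS1
  · refine ⟨X', U2, F2, t', T', 0, main 0 (Or.inl hS1), Or.inl ⟨rfl, P \ S.image μ, ?_, ?_⟩⟩
    · intro g
      simp only [mem_sdiff, mem_image, hP, hmem]
      constructor
      · rintro ⟨h1, h2⟩ j (h3 | ⟨h3, h4⟩)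
        · exact h1 j h3
        · exact h2 ⟨j, h3, h4.symm⟩
      · intro h1
        refine ⟨fun j hj => h1 j (Or.inl hj), ?_⟩
        rintro ⟨j, hj, hjg⟩
        exact h1 j (Or.inr ⟨hj, hjg.symm⟩)
    · obtain ⟨i, hi⟩ := h.nF
      have hiS : i ∈ S := by rw [hS1, hC]; exact Or.inl hi
      apply card_lt_card
      refine ⟨sdiff_subset, fun hsub => ?_⟩
      have := hsub (hμP i hiS)
      rw [mem_sdiff] at this
      exact this.2 (mem_image_of_mem _ hiS)
  · refine ⟨X', U2, F2, t', T', 1, main 1 (Or.inr rfl), Or.inr ⟨rfl, ?_⟩⟩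
    intro g
    by_cases hg : g ∈ P
    · have himg : S.image μ = P := by
        apply eq_of_subset_of_card_le
        · intro y hy
          obtain ⟨k, hk, rfl⟩ := mem_image.1 hy
          exact hμP k hk
        · rw [card_image_of_injOn hinj, hS1]
      rw [← himg] at hg
      obtain ⟨k, hk, rfl⟩ := mem_image.1 hg
      exact ⟨k, (hmem k _).2 (Or.inr ⟨hk, rfl⟩)⟩
    · rw [hP] at hg
      push Not at hg
      obtain ⟨j, hj⟩ := hg
      exact ⟨j, hmono j hj⟩

lemma efx_from_state {n : ℕ} {M : Type*} [Fintype M] [DecidableEq M] (u : Fin n → M → ℝ)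
    (a b : Fin n → ℝ) (hab : ∀ i, b i < a i) (hb : ∀ i, 0 < b i)
    (hbi : ∀ i g, u i g = a i ∨ u i g = b i) (p : ℕ) :
    ∀ (X : Fin n → Finset M) (U F : Finset (Fin n)) (t T : Fin n → ℕ) (s : ℕ),
    RoundInv u a b X U F t T s 0 → ∀ P : Finset M, (∀ g, g ∈ P ↔ ∀ j, g ∉ X j) → #P = p →
    ∃ X : Fin n → Finset M, IsAllocation X ∧ IsEFX u X := by
  induction p using Nat.strong_induction_on with
  | _ p ih =>
    intro X U F t T s h P hP hp
    by_cases hne : P.Nonempty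
    · obtain ⟨X', U', F', t', T', e, hinv, ⟨rfl, P', hP', hlt⟩ | ⟨rfl, hall⟩⟩ :=
        round_step u a b hab hb X U F t T s h P hP hne
      · exact ih #P' (hp ▸ hlt) X' U' F' t' T' (s + 1) hinv P' hP' rfl
      · exact ⟨X', ⟨hall, hinv.disj⟩,
          efx_of_inv u a b hab hb hbi X' U' F' t' T' (s + 1) 1 le_rfl hinv⟩
    · refine ⟨X, ⟨?_, h.disj⟩, efx_of_inv u a b hab hb hbi X U F t T s 0 zero_le_one h⟩
      intro g
      by_contra hcon
      push Not at hcon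
      exact hne ⟨g, (hP g).2 hcon⟩

/-- Every personalized bi-valued instance admits an EFX allocation. -/
theorem efx_exists_personalized_bivalued
    (n : ℕ) (hn : 0 < n) (M : Type*) [Fintype M] [DecidableEq M]
    (u : Fin n → M → ℝ) (a b : Fin n → ℝ)
    (hab : ∀ i, b i < a i) (hb : ∀ i, 0 < b i)
    (hbi : ∀ i g, u i g = a i ∨ u i g = b i) :
    ∃ X : Fin n → Finset M, IsAllocation X ∧ IsEFX u X := by
  refine efx_from_state u a b hab hb hbi _ (fun _ => ∅) ∅ ∅ (fun _ => 0) (fun _ => 0) 0 ?_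
    univ (by simp) rfl
  refine ⟨by simp, by simp, ⟨⟨0, hn⟩, by simp⟩, by simp, by simp, by simp, by simp, by simp,
    by simp, by simp, by simp, by simp⟩
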